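/- (Lemma 2) Let ρ_AB be a bipartite density matrix with Δ_cl^→(ρ_AB) < C_HV(ρ_AB), and suppose C_HV(ρ_AB) is attained by a complete projective measurement {P_i}. Then the state ρ'_AB = ∑_i (P_i ⊗ 1) ρ_AB (P_i ⊗ 1), obtained from ρ_AB by the local operation of dephasing Alice's system in {P_i}, satisfies Δ_cl^→(ρ'_AB) > Δ_cl^→(ρ_AB); i.e. Δ_cl^→ can increase under local operations. -/

import Mathlib

open Matrix Kronecker
open scoped ComplexOrder

noncomputable section

/-- von Neumann entropy (natural logarithm): `S(ρ) = -∑ λ_k log λ_k`. -/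
def vnEntropy {d : ℕ} (ρ : Matrix (Fin d) (Fin d) ℂ) : ℝ :=
  if h : ρ.IsHermitian then -∑ k, h.eigenvalues k * Real.log (h.eigenvalues k) else 0

/-- von Neumann entropy in bits (log base 2). -/
def vnEntropy2 {d : ℕ} (ρ : Matrix (Fin d) (Fin d) ℂ) : ℝ :=
  if h : ρ.IsHermitian then -∑ k, h.eigenvalues k * Real.logb 2 (h.eigenvalues k) else 0

/-- A density matrix: positive semidefinite with unit trace. -/
def IsDensityMatrix {n : Type} [Fintype n] [DecidableEq n] (ρ : Matrix n n ℂ) : Prop :=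
  ρ.PosSemidef ∧ ρ.trace = 1

/-- Partial trace over the B system. -/
def ptraceB {dA dB : ℕ} (ρ : Matrix (Fin dA × Fin dB) (Fin dA × Fin dB) ℂ) :
    Matrix (Fin dA) (Fin dA) ℂ :=
  Matrix.of fun a a' => ∑ b, ρ (a, b) (a', b)

/-- Partial trace over the A system. -/
def ptraceA {dA dB : ℕ} (ρ : Matrix (Fin dA × Fin dB) (Fin dA × Fin dB) ℂ) :
    Matrix (Fin dB) (Fin dB) ℂ :=
  Matrix.of fun b b' => ∑ a, ρ (a, b) (a, b')

/-- A projective measurement on `ℂ^{dA}`: a finite family of mutually orthogonal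
orthogonal projectors summing to the identity. -/
structure ProjMeas (dA m : ℕ) where
  P : Fin m → Matrix (Fin dA) (Fin dA) ℂ
  herm : ∀ i, (P i).IsHermitian
  idem : ∀ i, P i * P i = P i
  orth : ∀ i j, i ≠ j → P i * P j = 0
  sum_eq : ∑ i, P i = 1

/-- A measurement is complete if all projectors are rank one. -/
def ProjMeas.Complete {dA m : ℕ} (M : ProjMeas dA m) : Prop :=
  ∀ i, (M.P i).rank = 1

/-- Outcome probability `p_i = Tr[(P_i ⊗ 1) ρ]`. -/
def prob {dA dB m : ℕ} (ρ : Matrix (Fin dA × Fin dB) (Fin dA × Fin dB) ℂ)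
    (M : ProjMeas dA m) (i : Fin m) : ℝ :=
  (((M.P i ⊗ₖ (1 : Matrix (Fin dB) (Fin dB) ℂ)) * ρ).trace).re

/-- Conditional state of Bob: `Tr_A[(P_i ⊗ 1) ρ (P_i ⊗ 1)] / p_i`. -/
def condB {dA dB m : ℕ} (ρ : Matrix (Fin dA × Fin dB) (Fin dA × Fin dB) ℂ)
    (M : ProjMeas dA m) (i : Fin m) : Matrix (Fin dB) (Fin dB) ℂ :=
  ((prob ρ M i : ℂ))⁻¹ •
    ptraceA ((M.P i ⊗ₖ (1 : Matrix (Fin dB) (Fin dB) ℂ)) * ρ *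
      (M.P i ⊗ₖ (1 : Matrix (Fin dB) (Fin dB) ℂ)))

/-- `c_HV(ρ,{P_i}) = S(ρ_B) - ∑_i p_i S(ρ_i^B)`. -/
def cHV {dA dB m : ℕ} (ρ : Matrix (Fin dA × Fin dB) (Fin dA × Fin dB) ℂ)
    (M : ProjMeas dA m) : ℝ :=
  vnEntropy (ptraceA ρ) - ∑ i, prob ρ M i * vnEntropy (condB ρ M i)

/-- Same, in bits. -/
def cHV2 {dA dB m : ℕ} (ρ : Matrix (Fin dA × Fin dB) (Fin dA × Fin dB) ℂ)
    (M : ProjMeas dA m) : ℝ :=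
  vnEntropy2 (ptraceA ρ) - ∑ i, prob ρ M i * vnEntropy2 (condB ρ M i)

/-- Dephasing of a single-system state: `∑_i P_i σ P_i`. -/
def deph {d m : ℕ} (σ : Matrix (Fin d) (Fin d) ℂ) (M : ProjMeas d m) :
    Matrix (Fin d) (Fin d) ℂ :=
  ∑ i, M.P i * σ * M.P i

/-- `δ_cl^→(ρ,{P_i}) = S(ρ_A) - S(ρ'_A) + c_HV(ρ,{P_i})`. -/
def deltaCl {dA dB m : ℕ} (ρ : Matrix (Fin dA × Fin dB) (Fin dA × Fin dB) ℂ)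
    (M : ProjMeas dA m) : ℝ :=
  vnEntropy (ptraceB ρ) - vnEntropy (deph (ptraceB ρ) M) + cHV ρ M

/-- The Henderson–Vedral quantity: supremum of `c_HV` over complete projective measurements. -/
def CHV {dA dB : ℕ} (ρ : Matrix (Fin dA × Fin dB) (Fin dA × Fin dB) ℂ) : ℝ :=
  sSup {x : ℝ | ∃ m, ∃ M : ProjMeas dA m, M.Complete ∧ x = cHV ρ M}

/-- One-way classical information deficit: supremum of `δ_cl^→` over complete
projective measurements. -/
def DeltaCl {dA dB : ℕ} (ρ : Matrix (Fin dA × Fin dB) (Fin dA × Fin dB) ℂ) : ℝ :=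
  sSup {x : ℝ | ∃ m, ∃ M : ProjMeas dA m, M.Complete ∧ x = deltaCl ρ M}

/-- Alice-side dephasing of a bipartite state: `∑_i (P_i ⊗ 1) ρ (P_i ⊗ 1)`. -/
def dephAB {dA dB m : ℕ} (ρ : Matrix (Fin dA × Fin dB) (Fin dA × Fin dB) ℂ)
    (M : ProjMeas dA m) : Matrix (Fin dA × Fin dB) (Fin dA × Fin dB) ℂ :=
  ∑ i, (M.P i ⊗ₖ (1 : Matrix (Fin dB) (Fin dB) ℂ)) * ρ *
    (M.P i ⊗ₖ (1 : Matrix (Fin dB) (Fin dB) ℂ))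

/-- Outer product `|v⟩⟨v|`. -/
def outer {n : Type} [Fintype n] (v : n → ℂ) : Matrix n n ℂ :=
  Matrix.of fun x y => v x * star (v y)

theorem kronecker_one_mul_apply {dA dB : ℕ} (P : Matrix (Fin dA) (Fin dA) ℂ)
    (σ : Matrix (Fin dA × Fin dB) (Fin dA × Fin dB) ℂ) (a : Fin dA) (b : Fin dB)
    (y : Fin dA × Fin dB) :
    ((P ⊗ₖ (1 : Matrix (Fin dB) (Fin dB) ℂ)) * σ) (a, b) y = ∑ c, P a c * σ (c, b) y := by
  simp [Matrix.mul_apply, Fintype.sum_prod_type, Matrix.one_apply]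

theorem mul_kronecker_one_apply {dA dB : ℕ} (P : Matrix (Fin dA) (Fin dA) ℂ)
    (σ : Matrix (Fin dA × Fin dB) (Fin dA × Fin dB) ℂ) (a : Fin dA) (b : Fin dB)
    (x : Fin dA × Fin dB) :
    (σ * (P ⊗ₖ (1 : Matrix (Fin dB) (Fin dB) ℂ))) x (a, b) = ∑ c, σ x (c, b) * P c a := by
  simp [Matrix.mul_apply, Fintype.sum_prod_type, Matrix.one_apply]

theorem ptraceB_kronecker_one_mul {dA dB : ℕ} (P : Matrix (Fin dA) (Fin dA) ℂ)
    (σ : Matrix (Fin dA × Fin dB) (Fin dA × Fin dB) ℂ) :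
    ptraceB ((P ⊗ₖ (1 : Matrix (Fin dB) (Fin dB) ℂ)) * σ) = P * ptraceB σ := by
  ext a a'
  rw [Matrix.mul_apply]
  simp only [ptraceB, Matrix.of_apply, kronecker_one_mul_apply, Finset.mul_sum]
  exact Finset.sum_comm

theorem ptraceB_mul_kronecker_one {dA dB : ℕ} (P : Matrix (Fin dA) (Fin dA) ℂ)
    (σ : Matrix (Fin dA × Fin dB) (Fin dA × Fin dB) ℂ) :
    ptraceB (σ * (P ⊗ₖ (1 : Matrix (Fin dB) (Fin dB) ℂ))) = ptraceB σ * P := by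
  ext a a'
  rw [Matrix.mul_apply]
  simp only [ptraceB, Matrix.of_apply, mul_kronecker_one_apply, Finset.sum_mul]
  exact Finset.sum_comm

theorem ptraceA_mul_kronecker_one_comm {dA dB : ℕ} (P : Matrix (Fin dA) (Fin dA) ℂ)
    (σ : Matrix (Fin dA × Fin dB) (Fin dA × Fin dB) ℂ) :
    ptraceA (σ * (P ⊗ₖ (1 : Matrix (Fin dB) (Fin dB) ℂ))) =
      ptraceA ((P ⊗ₖ (1 : Matrix (Fin dB) (Fin dB) ℂ)) * σ) := by
  ext b b'
  simp only [ptraceA, Matrix.of_apply, mul_kronecker_one_apply, kronecker_one_mul_apply]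
  rw [Finset.sum_comm]
  simp only [mul_comm]

theorem ptraceA_sum {ι : Type} (s : Finset ι) {dA dB : ℕ}
    (f : ι → Matrix (Fin dA × Fin dB) (Fin dA × Fin dB) ℂ) :
    ptraceA (∑ i ∈ s, f i) = ∑ i ∈ s, ptraceA (f i) := by
  ext b b'
  simp only [ptraceA, Matrix.of_apply, Matrix.sum_apply]
  exact Finset.sum_comm

theorem ptraceB_sum {ι : Type} (s : Finset ι) {dA dB : ℕ}
    (f : ι → Matrix (Fin dA × Fin dB) (Fin dA × Fin dB) ℂ) :
    ptraceB (∑ i ∈ s, f i) = ∑ i ∈ s, ptraceB (f i) := by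
  ext b b'
  simp only [ptraceB, Matrix.of_apply, Matrix.sum_apply]
  exact Finset.sum_comm

theorem trace_ptraceA {dA dB : ℕ} (σ : Matrix (Fin dA × Fin dB) (Fin dA × Fin dB) ℂ) :
    (ptraceA σ).trace = σ.trace := by
  simp only [ptraceA, Matrix.trace, Matrix.diag, Matrix.of_apply, Fintype.sum_prod_type]
  exact Finset.sum_comm

theorem trace_ptraceB {dA dB : ℕ} (σ : Matrix (Fin dA × Fin dB) (Fin dA × Fin dB) ℂ) :
    (ptraceB σ).trace = σ.trace := by
  simp only [ptraceB, Matrix.trace, Matrix.diag, Matrix.of_apply, Fintype.sum_prod_type]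

theorem posSemidef_ptraceA {dA dB : ℕ} {σ : Matrix (Fin dA × Fin dB) (Fin dA × Fin dB) ℂ}
    (h : σ.PosSemidef) : (ptraceA σ).PosSemidef := by
  have e : ptraceA σ = ∑ a, σ.submatrix (fun b => (a, b)) (fun b => (a, b)) := by
    ext b b'
    simp [ptraceA, Matrix.sum_apply]
  rw [e]
  exact Matrix.posSemidef_sum _ fun a _ => h.submatrix _

theorem posSemidef_ptraceB {dA dB : ℕ} {σ : Matrix (Fin dA × Fin dB) (Fin dA × Fin dB) ℂ}
    (h : σ.PosSemidef) : (ptraceB σ).PosSemidef := by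
  have e : ptraceB σ = ∑ b, σ.submatrix (fun a => (a, b)) (fun a => (a, b)) := by
    ext a a'
    simp [ptraceB, Matrix.sum_apply]
  rw [e]
  exact Matrix.posSemidef_sum _ fun b _ => h.submatrix _

theorem vnEntropy_nonneg {d : ℕ} {σ : Matrix (Fin d) (Fin d) ℂ} (h : σ.PosSemidef)
    (ht : σ.trace.re ≤ 1) : 0 ≤ vnEntropy σ := by
  have hsum : ∑ k, h.isHermitian.eigenvalues k ≤ 1 := by
    rw [h.isHermitian.trace_eq_sum_eigenvalues] at ht
    simpa using ht
  rw [vnEntropy, dif_pos h.isHermitian, ← Finset.sum_neg_distrib]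
  refine Finset.sum_nonneg fun k _ => ?_
  have h0 := h.eigenvalues_nonneg k
  have h1 : h.isHermitian.eigenvalues k ≤ 1 :=
    (Finset.single_le_sum (fun j _ => h.eigenvalues_nonneg j) (Finset.mem_univ k)).trans hsum
  exact neg_nonneg.2 (mul_nonpos_of_nonneg_of_nonpos h0 (Real.log_nonpos h0 h1))

section ProjMeas

variable {dA dB m : ℕ} (M : ProjMeas dA m)

theorem ProjMeas.kronecker_one_mul (i j : Fin m) :
    (M.P i ⊗ₖ (1 : Matrix (Fin dB) (Fin dB) ℂ)) * (M.P j ⊗ₖ (1 : Matrix (Fin dB) (Fin dB) ℂ)) =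
      if i = j then M.P i ⊗ₖ (1 : Matrix (Fin dB) (Fin dB) ℂ) else 0 := by
  rw [← Matrix.mul_kronecker_mul, Matrix.one_mul]
  split_ifs with h
  · rw [← h, M.idem]
  · rw [M.orth i j h, Matrix.zero_kronecker]

theorem ProjMeas.kronecker_one_sum :
    ∑ i, M.P i ⊗ₖ (1 : Matrix (Fin dB) (Fin dB) ℂ) = 1 := by
  rw [← Matrix.one_kronecker_one, ← M.sum_eq]
  ext x y
  simp [Matrix.sum_apply, Finset.sum_mul]

theorem ProjMeas.isHermitian_kronecker_one (i : Fin m) :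
    (M.P i ⊗ₖ (1 : Matrix (Fin dB) (Fin dB) ℂ)).IsHermitian := by
  rw [Matrix.IsHermitian, Matrix.conjTranspose_kronecker, M.herm i, Matrix.conjTranspose_one]

theorem posSemidef_kronecker_one_conj {σ : Matrix (Fin dA × Fin dB) (Fin dA × Fin dB) ℂ}
    (h : σ.PosSemidef) (i : Fin m) :
    ((M.P i ⊗ₖ (1 : Matrix (Fin dB) (Fin dB) ℂ)) * σ *
      (M.P i ⊗ₖ (1 : Matrix (Fin dB) (Fin dB) ℂ))).PosSemidef := by
  have := h.mul_mul_conjTranspose_same (M.P i ⊗ₖ (1 : Matrix (Fin dB) (Fin dB) ℂ))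
  rwa [M.isHermitian_kronecker_one i] at this

theorem posSemidef_dephAB {σ : Matrix (Fin dA × Fin dB) (Fin dA × Fin dB) ℂ}
    (h : σ.PosSemidef) : (dephAB σ M).PosSemidef :=
  Matrix.posSemidef_sum _ fun i _ => posSemidef_kronecker_one_conj M h i

theorem trace_kronecker_one_conj (σ : Matrix (Fin dA × Fin dB) (Fin dA × Fin dB) ℂ) (i : Fin m) :
    ((M.P i ⊗ₖ (1 : Matrix (Fin dB) (Fin dB) ℂ)) * σ *
      (M.P i ⊗ₖ (1 : Matrix (Fin dB) (Fin dB) ℂ))).trace =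
      ((M.P i ⊗ₖ (1 : Matrix (Fin dB) (Fin dB) ℂ)) * σ).trace := by
  rw [Matrix.trace_mul_comm, ← Matrix.mul_assoc, M.kronecker_one_mul, if_pos rfl]

theorem ptraceA_dephAB (σ : Matrix (Fin dA × Fin dB) (Fin dA × Fin dB) ℂ) :
    ptraceA (dephAB σ M) = ptraceA σ := by
  rw [dephAB, ptraceA_sum]
  simp only [ptraceA_mul_kronecker_one_comm, ← Matrix.mul_assoc, M.kronecker_one_mul, if_pos]
  rw [← ptraceA_sum, ← Finset.sum_mul, M.kronecker_one_sum, Matrix.one_mul]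

theorem ptraceB_dephAB (σ : Matrix (Fin dA × Fin dB) (Fin dA × Fin dB) ℂ) :
    ptraceB (dephAB σ M) = deph (ptraceB σ) M := by
  simp only [dephAB, deph, ptraceB_sum, ptraceB_mul_kronecker_one, ptraceB_kronecker_one_mul]

theorem trace_dephAB (σ : Matrix (Fin dA × Fin dB) (Fin dA × Fin dB) ℂ) :
    (dephAB σ M).trace = σ.trace := by
  rw [← trace_ptraceA, ptraceA_dephAB, trace_ptraceA]

theorem kronecker_one_mul_dephAB (σ : Matrix (Fin dA × Fin dB) (Fin dA × Fin dB) ℂ) (i : Fin m) :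
    (M.P i ⊗ₖ (1 : Matrix (Fin dB) (Fin dB) ℂ)) * dephAB σ M =
      (M.P i ⊗ₖ (1 : Matrix (Fin dB) (Fin dB) ℂ)) * σ *
        (M.P i ⊗ₖ (1 : Matrix (Fin dB) (Fin dB) ℂ)) := by
  simp [dephAB, Finset.mul_sum, ← Matrix.mul_assoc, M.kronecker_one_mul, ite_mul]

theorem dephAB_dephAB (σ : Matrix (Fin dA × Fin dB) (Fin dA × Fin dB) ℂ) :
    dephAB (dephAB σ M) M = dephAB σ M := by
  rw [dephAB]
  simp only [kronecker_one_mul_dephAB, Matrix.mul_assoc, M.kronecker_one_mul, if_pos]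
  simp only [dephAB, Matrix.mul_assoc]

theorem prob_dephAB (σ : Matrix (Fin dA × Fin dB) (Fin dA × Fin dB) ℂ) (i : Fin m) :
    prob (dephAB σ M) M i = prob σ M i := by
  rw [prob, kronecker_one_mul_dephAB, trace_kronecker_one_conj, prob]

theorem condB_dephAB (σ : Matrix (Fin dA × Fin dB) (Fin dA × Fin dB) ℂ) (i : Fin m) :
    condB (dephAB σ M) M i = condB σ M i := by
  rw [condB, prob_dephAB, kronecker_one_mul_dephAB, Matrix.mul_assoc, M.kronecker_one_mul,
    if_pos rfl, condB]

theorem cHV_dephAB (σ : Matrix (Fin dA × Fin dB) (Fin dA × Fin dB) ℂ) :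
    cHV (dephAB σ M) M = cHV σ M := by
  simp only [cHV, ptraceA_dephAB, prob_dephAB, condB_dephAB]

theorem deltaCl_dephAB (σ : Matrix (Fin dA × Fin dB) (Fin dA × Fin dB) ℂ) :
    deltaCl (dephAB σ M) M = cHV σ M := by
  rw [deltaCl, ← ptraceB_dephAB, dephAB_dephAB, sub_self, zero_add, cHV_dephAB]

theorem prob_nonneg {σ : Matrix (Fin dA × Fin dB) (Fin dA × Fin dB) ℂ} (h : σ.PosSemidef)
    (i : Fin m) : 0 ≤ prob σ M i := by
  rw [prob, ← trace_kronecker_one_conj]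
  exact (Complex.nonneg_iff.1 (posSemidef_kronecker_one_conj M h i).trace_nonneg).1

theorem vnEntropy_condB_nonneg {σ : Matrix (Fin dA × Fin dB) (Fin dA × Fin dB) ℂ}
    (h : σ.PosSemidef) (i : Fin m) : 0 ≤ vnEntropy (condB σ M i) := by
  apply vnEntropy_nonneg
  · refine (posSemidef_ptraceA (posSemidef_kronecker_one_conj M h i)).smul ?_
    rw [← Complex.ofReal_inv]
    exact Complex.zero_le_real.2 (inv_nonneg.2 (prob_nonneg M h i))
  · rw [condB, Matrix.trace_smul, trace_ptraceA, trace_kronecker_one_conj, smul_eq_mul,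
      ← Complex.ofReal_inv, Complex.re_ofReal_mul]
    exact inv_mul_le_one

theorem deltaCl_le {σ : Matrix (Fin dA × Fin dB) (Fin dA × Fin dB) ℂ}
    (h : IsDensityMatrix σ) :
    deltaCl σ M ≤ vnEntropy (ptraceB σ) + vnEntropy (ptraceA σ) := by
  have hdeph : 0 ≤ vnEntropy (deph (ptraceB σ) M) := by
    rw [← ptraceB_dephAB]
    refine vnEntropy_nonneg (posSemidef_ptraceB (posSemidef_dephAB M h.1)) ?_
    rw [trace_ptraceB, trace_dephAB, h.2, Complex.one_re]
  have hcond : 0 ≤ ∑ i, prob σ M i * vnEntropy (condB σ M i) :=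
    Finset.sum_nonneg fun i _ => mul_nonneg (prob_nonneg M h.1 i) (vnEntropy_condB_nonneg M h.1 i)
  rw [deltaCl, cHV]
  linarith

theorem deltaCl_le_DeltaCl {σ : Matrix (Fin dA × Fin dB) (Fin dA × Fin dB) ℂ}
    (h : IsDensityMatrix σ) (hM : M.Complete) : deltaCl σ M ≤ DeltaCl σ := by
  refine le_csSup ⟨vnEntropy (ptraceB σ) + vnEntropy (ptraceA σ), ?_⟩ ⟨m, M, hM, rfl⟩
  rintro _ ⟨_, N, _, rfl⟩
  exact deltaCl_le N h

end ProjMeas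

/-- Lemma 2: if `Δ_cl^→(ρ) < C_HV(ρ)` and `C_HV(ρ)` is attained by a
complete projective measurement `{P_i}`, then Alice's local dephasing in `{P_i}`
strictly increases the one-way classical information deficit. -/
theorem DeltaCl_increase_under_local {dA dB m : ℕ}
    (ρ : Matrix (Fin dA × Fin dB) (Fin dA × Fin dB) ℂ) (hρ : IsDensityMatrix ρ)
    (hlt : DeltaCl ρ < CHV ρ)
    (M : ProjMeas dA m) (hM : M.Complete) (hopt : cHV ρ M = CHV ρ) :
    DeltaCl (dephAB ρ M) > DeltaCl ρ := by
  have hd : IsDensityMatrix (dephAB ρ M) :=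
    ⟨posSemidef_dephAB M hρ.1, (trace_dephAB M ρ).trans hρ.2⟩
  calc DeltaCl ρ < CHV ρ := hlt
    _ = deltaCl (dephAB ρ M) M := by rw [deltaCl_dephAB, hopt]
    _ ≤ DeltaCl (dephAB ρ M) := deltaCl_le_DeltaCl M hd hM

end
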